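/- Let 𝔤 = 𝒜₄,₁₀ be the 4-dimensional real Lie algebra with brackets [e₂,e₃] = e₁, [e₂,e₄] = −e₃, [e₃,e₄] = e₂. Then for every inner product g on 𝔤 and every alternating 2-form F on 𝔤 such that (g,F) is a solution of the Einstein–Maxwell equations, the metric g is Einstein. -/

import Mathlib

open scoped BigOperators

noncomputable section

/-- The underlying vector space `ℝ⁴` of the 4-dimensional Lie algebra. -/
abbrev V4 : Type := Fin 4 → ℝ

/-- The standard basis `e₁, e₂, e₃, e₄` (0-indexed). -/
def ee (i : Fin 4) : V4 := Pi.single i 1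

/-- `g` is an inner product: a positive-definite symmetric bilinear form. -/
structure IsInnerProduct (g : V4 → V4 → ℝ) : Prop where
  symm : ∀ x y, g x y = g y x
  add_left : ∀ x y z, g (x + y) z = g x z + g y z
  smul_left : ∀ (a : ℝ) (x y : V4), g (a • x) y = a * g x y
  pos : ∀ x : V4, x ≠ 0 → 0 < g x x

/-- `F` is an alternating bilinear 2-form. -/
structure IsAltForm (F : V4 → V4 → ℝ) : Prop where
  skew : ∀ x y, F x y = - F y x
  add_left : ∀ x y z, F (x + y) z = F x z + F y z
  smul_left : ∀ (a : ℝ) (x y : V4), F (a • x) y = a * F x y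

/-- Chevalley–Eilenberg differential of a 2-form with respect to the bracket `br`:
`dF(x,y,z) = −F([x,y],z) + F([x,z],y) − F([y,z],x)`. -/
def cdiff (br : V4 → V4 → V4) (F : V4 → V4 → ℝ) (x y z : V4) : ℝ :=
  - F (br x y) z + F (br x z) y - F (br y z) x

/-- A 2-form is closed if its Chevalley–Eilenberg differential vanishes. -/
def IsClosedForm (br : V4 → V4 → V4) (F : V4 → V4 → ℝ) : Prop :=
  ∀ x y z, cdiff br F x y z = 0

/-- The Gram matrix of a bilinear form in the standard basis. -/
def gram (g : V4 → V4 → ℝ) : Matrix (Fin 4) (Fin 4) ℝ :=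
  Matrix.of fun i j => g (ee i) (ee j)

/-- The inverse Gram matrix. -/
def ginv (g : V4 → V4 → ℝ) : Matrix (Fin 4) (Fin 4) ℝ := (gram g)⁻¹

/-- The inner product induced by `g` on 2-forms:
`⟨α,β⟩ = (1/2) Σ g^{ik} g^{jl} α_{ij} β_{kl}`. -/
def formInner (g : V4 → V4 → ℝ) (α β : V4 → V4 → ℝ) : ℝ :=
  (1 / 2) * ∑ i, ∑ j, ∑ k, ∑ l,
    ginv g i k * ginv g j l * α (ee i) (ee j) * β (ee k) (ee l)

/-- The volume form of `g` for the orientation `e¹∧e²∧e³∧e⁴`. -/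
def vol (g : V4 → V4 → ℝ) (x y z w : V4) : ℝ :=
  Real.sqrt (gram g).det * Matrix.det (Matrix.of fun i j => ![x, y, z, w] i j)

/-- The wedge product of two 2-forms, as a 4-form. -/
def wedge22 (α β : V4 → V4 → ℝ) (x y z w : V4) : ℝ :=
  α x y * β z w - α x z * β y w + α x w * β y z
    + α z w * β x y - α y w * β x z + α y z * β x w

/-- `sF` is the Hodge star `⋆F` of `F` with respect to `g` and the orientation
`e¹∧e²∧e³∧e⁴`: it is the 2-form with `α ∧ sF = ⟨α,F⟩_g vol_g` for all 2-forms `α`. -/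
def IsHodgeStar (g : V4 → V4 → ℝ) (F sF : V4 → V4 → ℝ) : Prop :=
  IsAltForm sF ∧
    ∀ α : V4 → V4 → ℝ, IsAltForm α → ∀ x y z w,
      wedge22 α sF x y z w = formInner g α F * vol g x y z w

/-- `F` is co-closed: `d(⋆F) = 0`. -/
def IsCoclosed (br : V4 → V4 → V4) (g F : V4 → V4 → ℝ) : Prop :=
  ∃ sF, IsHodgeStar g F sF ∧ IsClosedForm br sF

/-- Koszul expression: `g(∇ₓy, z) = (1/2)(g([x,y],z) − g([y,z],x) + g([z,x],y))`. -/
def koszul (br : V4 → V4 → V4) (g : V4 → V4 → ℝ) (x y z : V4) : ℝ :=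
  (1 / 2) * (g (br x y) z - g (br y z) x + g (br z x) y)

/-- The Levi-Civita product `∇ₓ y`, i.e. the unique vector with
`g(∇ₓy, z) = koszul x y z` for all `z` (computed via the inverse Gram matrix). -/
def LC (br : V4 → V4 → V4) (g : V4 → V4 → ℝ) (x y : V4) : V4 :=
  fun m => ∑ k, koszul br g x y (ee k) * ginv g k m

/-- Curvature `R(x,y)z = ∇ₓ∇_y z − ∇_y∇ₓ z − ∇_{[x,y]} z`. -/
def curv (br : V4 → V4 → V4) (g : V4 → V4 → ℝ) (x y z : V4) : V4 :=
  LC br g x (LC br g y z) - LC br g y (LC br g x z) - LC br g (br x y) z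

/-- Ricci tensor `Ric(x,y) = Σᵢ g(R(vᵢ,x)y, vᵢ)` for a `g`-orthonormal basis `(vᵢ)`,
i.e. the trace of the endomorphism `z ↦ R(z,x)y`. -/
def ricci (br : V4 → V4 → V4) (g : V4 → V4 → ℝ) (x y : V4) : ℝ :=
  ∑ i, curv br g (ee i) x y i

/-- Scalar curvature: the `g`-trace of the Ricci tensor. -/
def scal (br : V4 → V4 → V4) (g : V4 → V4 → ℝ) : ℝ :=
  ∑ a, ∑ b, ginv g a b * ricci br g (ee a) (ee b)

/-- Trace-free Ricci tensor `Ric₀ = Ric − (s/4) g`. -/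
def ricci0 (br : V4 → V4 → V4) (g : V4 → V4 → ℝ) (x y : V4) : ℝ :=
  ricci br g x y - (scal br g / 4) * g x y

/-- `g` is Einstein: `Ric₀ = 0`. -/
def IsEinstein (br : V4 → V4 → V4) (g : V4 → V4 → ℝ) : Prop :=
  ∀ x y, ricci0 br g x y = 0

/-- The endomorphism `F̂` with `g(F̂x, y) = F(x,y)` (computed via the inverse Gram matrix). -/
def fhat (g F : V4 → V4 → ℝ) (x : V4) : V4 :=
  fun m => ∑ k, F x (ee k) * ginv g k m

/-- `[F∘F]₀(x,y) = g(F̂(F̂x), y) − (1/4) tr(F̂∘F̂) g(x,y)`. -/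
def FF0 (g F : V4 → V4 → ℝ) (x y : V4) : ℝ :=
  g (fhat g F (fhat g F x)) y
    - (1 / 4) * (∑ i, fhat g F (fhat g F (ee i)) i) * g x y

/-- `(g, F)` is a solution of the Einstein--Maxwell equations:
`dF = 0`, `d(⋆F) = 0`, and `Ric₀ = −[F∘F]₀`. -/
def IsEMSolution (br : V4 → V4 → V4) (g F : V4 → V4 → ℝ) : Prop :=
  IsClosedForm br F ∧ IsCoclosed br g F ∧ ∀ x y, ricci0 br g x y = - FF0 g F x y

/-- Nijenhuis tensor `N_J(x,y) = [Jx,Jy] − J[Jx,y] − J[x,Jy] − [x,y]`. -/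
def nijenhuis (br : V4 → V4 → V4) (J : V4 →ₗ[ℝ] V4) (x y : V4) : V4 :=
  br (J x) (J y) - J (br (J x) y) - J (br x (J y)) - br x y

/-- The Lie algebra `𝒜₄,₁₀`: `[e₂,e₃] = e₁`, `[e₂,e₄] = −e₃`, `[e₃,e₄] = e₂`. -/
def brA410 : V4 → V4 → V4 := fun x y =>
  (x 1 * y 2 - x 2 * y 1) • ee 0
    + (x 2 * y 3 - x 3 * y 2) • ee 1
    + (-(x 1 * y 3 - x 3 * y 1)) • ee 2

theorem sum_smul_ee (x : V4) : ∑ i, x i • ee i = x := by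
  ext j
  simp [ee, Finset.sum_apply, Pi.single_apply]

theorem map_eq_sum_of_linear {f : V4 → ℝ} (hadd : ∀ x y, f (x + y) = f x + f y)
    (hsmul : ∀ (a : ℝ) x, f (a • x) = a * f x) (x : V4) : f x = ∑ i, x i * f (ee i) := by
  let L : V4 →ₗ[ℝ] ℝ := { toFun := f, map_add' := hadd, map_smul' := hsmul }
  calc f x = L (∑ i, x i • ee i) := by rw [sum_smul_ee]; rfl
    _ = ∑ i, x i * f (ee i) := by simp only [map_sum, map_smul, smul_eq_mul]; rfl

theorem IsInnerProduct.eq_sum_left {g : V4 → V4 → ℝ} (hg : IsInnerProduct g) (x y : V4) :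
    g x y = ∑ i, x i * g (ee i) y :=
  map_eq_sum_of_linear (f := (g · y)) (hg.add_left · · y) (hg.smul_left · · y) x

theorem IsInnerProduct.zero_left {g : V4 → V4 → ℝ} (hg : IsInnerProduct g) (y : V4) :
    g 0 y = 0 := by
  simp [hg.eq_sum_left 0 y]

theorem IsAltForm.eq_sum_left {F : V4 → V4 → ℝ} (hF : IsAltForm F) (x y : V4) :
    F x y = ∑ i, x i * F (ee i) y :=
  map_eq_sum_of_linear (f := (F · y)) (hF.add_left · · y) (hF.smul_left · · y) x

theorem IsAltForm.zero_left {F : V4 → V4 → ℝ} (hF : IsAltForm F) (y : V4) : F 0 y = 0 := by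
  simp [hF.eq_sum_left 0 y]

theorem IsAltForm.self {F : V4 → V4 → ℝ} (hF : IsAltForm F) (x : V4) : F x x = 0 := by
  linarith [hF.skew x x]

theorem IsAltForm.neg_left {F : V4 → V4 → ℝ} (hF : IsAltForm F) (x y : V4) :
    F (-x) y = -F x y := by
  simpa using hF.smul_left (-1) x y

theorem IsAltForm.eq_zero_of_basis {F : V4 → V4 → ℝ} (hF : IsAltForm F)
    (h : ∀ i j, F (ee i) (ee j) = 0) (x y : V4) : F x y = 0 := by
  rw [hF.eq_sum_left]
  refine Finset.sum_eq_zero fun i _ => ?_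
  rw [hF.skew, hF.eq_sum_left]
  simp [h]

theorem IsInnerProduct.posDef_gram {g : V4 → V4 → ℝ} (hg : IsInnerProduct g) :
    (gram g).PosDef := by
  refine Matrix.PosDef.of_dotProduct_mulVec_pos ?_ fun x hx => ?_
  · ext i j
    simp [gram, hg.symm (ee i) (ee j)]
  · have key : star x ⬝ᵥ (gram g).mulVec x = g x x := by
      rw [hg.eq_sum_left x x]
      refine Finset.sum_congr rfl fun i _ => ?_
      rw [hg.symm, hg.eq_sum_left x]
      simp only [Matrix.mulVec, dotProduct, gram, Matrix.of_apply, star_trivial]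
      congr 1
      exact Finset.sum_congr rfl fun j _ => by rw [hg.symm, mul_comm]
    rw [key]
    exact hg.pos x hx

open scoped Kronecker in
theorem IsInnerProduct.formInner_self_pos {g F : V4 → V4 → ℝ} (hg : IsInnerProduct g)
    {i j : Fin 4} (h : F (ee i) (ee j) ≠ 0) : 0 < formInner g F F := by
  have hG : (ginv g ⊗ₖ ginv g).PosDef := hg.posDef_gram.inv.kronecker hg.posDef_gram.inv
  have hv : (fun p : Fin 4 × Fin 4 => F (ee p.1) (ee p.2)) ≠ 0 :=
    fun h0 => h (congrFun h0 (i, j))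
  have hpos := hG.dotProduct_mulVec_pos hv
  have key : formInner g F F = (1 / 2) * (star (fun p : Fin 4 × Fin 4 => F (ee p.1) (ee p.2)) ⬝ᵥ
      (ginv g ⊗ₖ ginv g).mulVec fun p : Fin 4 × Fin 4 => F (ee p.1) (ee p.2)) := by
    simp only [formInner, dotProduct, Matrix.mulVec, Fintype.sum_prod_type, Finset.mul_sum,
      Matrix.kroneckerMap_apply, Pi.star_apply, star_trivial]
    refine Finset.sum_congr rfl fun a _ => Finset.sum_congr rfl fun b _ =>
      Finset.sum_congr rfl fun c _ => Finset.sum_congr rfl fun d _ => ?_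
    ring
  rw [key]
  positivity

theorem IsInnerProduct.vol_basis_pos {g : V4 → V4 → ℝ} (hg : IsInnerProduct g) :
    0 < vol g (ee 0) (ee 1) (ee 2) (ee 3) := by
  have h1 : (Matrix.of fun i j => ![ee 0, ee 1, ee 2, ee 3] i j) = 1 := by
    ext i j
    fin_cases i <;> fin_cases j <;> simp [ee]
  rw [vol, h1, Matrix.det_one, mul_one]
  exact Real.sqrt_pos.2 hg.posDef_gram.det_pos

/-- Every closed 2-form on `𝒜₄,₁₀` has the central vector `e₁` in its kernel. -/
theorem IsAltForm.ee_zero_eq_zero_of_isClosedForm_brA410 {F : V4 → V4 → ℝ} (hF : IsAltForm F)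
    (hd : IsClosedForm brA410 F) (j : Fin 4) : F (ee 0) (ee j) = 0 := by
  have h1 := hd (ee 0) (ee 2) (ee 3)
  have h2 := hd (ee 0) (ee 1) (ee 3)
  have h3 := hd (ee 1) (ee 2) (ee 3)
  simp [cdiff, brA410, ee, hF.zero_left, hF.neg_left, hF.self] at h1 h2 h3
  simp only [ee]
  fin_cases j
  · exact hF.self _
  · have := hF.skew (Pi.single 0 1) (Pi.single 1 1)
    simp_all
  · have := hF.skew (Pi.single 0 1) (Pi.single 2 1)
    simp_all
  · simp_all

/-- On `𝒜₄,₁₀` the only closed and co-closed 2-form is zero. -/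
theorem IsAltForm.eq_zero_of_closed_of_coclosed_brA410 {g F : V4 → V4 → ℝ}
    (hg : IsInnerProduct g) (hF : IsAltForm F) (hd : IsClosedForm brA410 F)
    (hcd : IsCoclosed brA410 g F) (x y : V4) : F x y = 0 := by
  obtain ⟨sF, ⟨hsF, hstar⟩, hdsF⟩ := hcd
  have hw := hstar F hF (ee 0) (ee 1) (ee 2) (ee 3)
  have hF0 := hF.ee_zero_eq_zero_of_isClosedForm_brA410 hd
  have hsF0 := hsF.ee_zero_eq_zero_of_isClosedForm_brA410 hdsF
  have hnorm : formInner g F F = 0 := by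
    simpa [wedge22, hF0, hsF0, hg.vol_basis_pos.ne'] using hw
  refine hF.eq_zero_of_basis (fun i j => ?_) x y
  by_contra h
  exact (hg.formInner_self_pos h).ne' hnorm

/-- `𝒜₄,₁₀` admits no left-invariant non-Einstein solution to the Einstein--Maxwell equations. -/
theorem stmt16 :
    ∀ g F : V4 → V4 → ℝ, IsInnerProduct g → IsAltForm F →
      IsEMSolution (brA410) g F → IsEinstein (brA410) g := by
  intro g F hg hF ⟨hd, hcd, hEM⟩ x y
  have hF0 := hF.eq_zero_of_closed_of_coclosed_brA410 hg hd hcd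
  have hhat : ∀ z, fhat g F z = 0 := fun z => by ext m; simp [fhat, hF0]
  simp [hEM, FF0, hhat, hg.zero_left]
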